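/- Let β ∈ (−1, 1), μ ∈ ℝ and t > 0. Then 4β ∫₀^∞ ∫₀^t h(t − τ; (1+β) b, μ) · h(τ; (1−β) b, μ) dτ db = (√2 β / √(π t)) · e^{−μ² t / 2} − β μ · erfc( μ √(t/2) ). -/

import Mathlib

open MeasureTheory Real Set Filter

/-- The auxiliary density `h(t; x, μ) = |x| / √(2π t³) · exp(−(x + μ t)² / (2t))`. -/
noncomputable def h (t x μ : ℝ) : ℝ :=
  |x| / Real.sqrt (2 * Real.pi * t ^ 3) * Real.exp (-(x + μ * t) ^ 2 / (2 * t))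

/-- The complementary error function `erfc(z) = (2/√π) ∫_z^∞ e^{−u²} du`. -/
noncomputable def erfc (z : ℝ) : ℝ :=
  2 / Real.sqrt Real.pi * ∫ u in Ioi z, Real.exp (-u ^ 2)

lemma integrable_exp_neg_sq : Integrable (fun u : ℝ => Real.exp (-u ^ 2)) := by
  simpa using integrable_exp_neg_mul_sq (b := 1) one_pos

/-- The Gaussian tail integral `∫_v^∞ e^{-u²} du`. -/
noncomputable def gaussTail (v : ℝ) : ℝ := ∫ u in Ioi v, Real.exp (-u ^ 2)

lemma gaussTail_eq (v : ℝ) :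
    gaussTail v = gaussTail 0 - ∫ u in (0 : ℝ)..v, Real.exp (-u ^ 2) := by
  have := intervalIntegral.integral_Ioi_sub_Ioi' (a := 0) (b := v)
    integrable_exp_neg_sq.integrableOn integrable_exp_neg_sq.integrableOn
  unfold gaussTail
  linarith

lemma hasDerivAt_gaussTail (v : ℝ) : HasDerivAt gaussTail (-Real.exp (-v ^ 2)) v := by
  have hc : Continuous (fun u : ℝ => Real.exp (-u ^ 2)) := by fun_prop
  have := (hc.integral_hasStrictDerivAt 0 v).hasDerivAt.const_sub (gaussTail 0)
  exact this.congr_of_eventuallyEq (Eventually.of_forall gaussTail_eq)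

lemma tendsto_gaussTail_atTop : Tendsto gaussTail atTop (nhds 0) := by
  have := (intervalIntegral_tendsto_integral_Ioi (0 : ℝ)
    integrable_exp_neg_sq.integrableOn tendsto_id).const_sub (gaussTail 0)
  have h0 : gaussTail 0 - ∫ u in Ioi (0 : ℝ), Real.exp (-u ^ 2) = 0 := sub_self _
  rw [h0] at this
  exact this.congr fun v => (gaussTail_eq v).symm

lemma tendsto_gaussTail_atBot : Tendsto gaussTail atBot (nhds (Real.sqrt Real.pi)) := by
  have := (intervalIntegral_tendsto_integral_Iic (0 : ℝ)
    integrable_exp_neg_sq.integrableOn tendsto_id).const_add (gaussTail 0)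
  have h0 : gaussTail 0 + ∫ u in Iic (0 : ℝ), Real.exp (-u ^ 2) = Real.sqrt Real.pi := by
    have h1 := intervalIntegral.integral_Iic_add_Ioi (b := (0 : ℝ))
      integrable_exp_neg_sq.integrableOn integrable_exp_neg_sq.integrableOn
    have h2 := integral_gaussian 1
    simp only [neg_mul, one_mul, div_one] at h2
    unfold gaussTail
    linarith
  rw [h0] at this
  refine this.congr fun v => ?_
  rw [gaussTail_eq v, intervalIntegral.integral_symm, id, sub_eq_add_neg]

lemma h_nonneg (t x μ : ℝ) : 0 ≤ h t x μ := by
  unfold h; positivity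

lemma integral_eq_of_hasDerivAt_of_tendsto_of_nonneg {f f' : ℝ → ℝ} {a b fa fb : ℝ}
    (hab : a < b) (hderiv : ∀ x ∈ Ioo a b, HasDerivAt f (f' x) x)
    (hpos : ∀ x ∈ Ioo a b, 0 ≤ f' x)
    (ha : Tendsto f (nhdsWithin a (Ioi a)) (nhds fa))
    (hb : Tendsto f (nhdsWithin b (Iio b)) (nhds fb)) :
    ∫ x in a..b, f' x = fb - fa := by
  refine intervalIntegral.integral_eq_sub_of_hasDerivAt_of_tendsto hab hderiv ?_ ha hb
  rw [intervalIntegrable_iff_integrableOn_Ioc_of_le hab.le]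
  have hcont : ContinuousOn (extendFrom (Ioo a b) f) (Icc a b) :=
    continuousOn_Icc_extendFrom_Ioo
      (fun x hx => (hderiv x hx).continuousAt.continuousWithinAt) ha hb
  refine intervalIntegral.integrableOn_deriv_of_nonneg hcont (fun x hx => ?_) hpos
  refine (hderiv x hx).congr_of_eventuallyEq ?_
  filter_upwards [Ioo_mem_nhds hx.1 hx.2] with y hy
  exact extendFrom_eq (subset_closure hy)
    ((hderiv y hy).continuousAt.continuousWithinAt)

lemma hasDerivAt_scaled_ratio {t x y τ : ℝ} (hτ : τ ∈ Ioo 0 t) :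
    HasDerivAt (fun τ => (x * τ - y * (t - τ)) * (Real.sqrt (2 * t * (τ * (t - τ))))⁻¹)
      (t ^ 2 * (x * τ + y * (t - τ)) / Real.sqrt (2 * t * (τ * (t - τ))) ^ 3) τ := by
  obtain ⟨h0, h1⟩ := hτ
  have hs : 0 < t - τ := sub_pos.2 h1
  have ht : 0 < t := h0.trans h1
  have hq : 0 < 2 * t * (τ * (t - τ)) := by positivity
  have hr := Real.sqrt_pos.2 hq
  have hsq := Real.sq_sqrt hq.le
  have hdq : HasDerivAt (fun τ => 2 * t * (τ * (t - τ))) (2 * t * (t - 2 * τ)) τ := by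
    have := ((hasDerivAt_id τ).mul ((hasDerivAt_id τ).const_sub t)).const_mul (2 * t)
    refine this.congr_deriv ?_
    simp only [id]; ring
  have hdn : HasDerivAt (fun τ => x * τ - y * (t - τ)) (x + y) τ := by
    have := ((hasDerivAt_id τ).const_mul x).sub (((hasDerivAt_id τ).const_sub t).const_mul y)
    refine this.congr_deriv ?_
    ring
  refine (hdn.mul ((hdq.sqrt hq.ne').inv hr.ne')).congr_deriv ?_
  simp only [Pi.inv_apply]
  set r := Real.sqrt (2 * t * (τ * (t - τ)))
  field_simp
  rw [hsq]
  ring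

lemma tendsto_inv_sqrt_atTop {l : Filter ℝ} {q : ℝ → ℝ} (hq : Tendsto q l (nhds 0))
    (hpos : ∀ᶠ τ in l, 0 < q τ) :
    Tendsto (fun τ => (Real.sqrt (q τ))⁻¹) l atTop := by
  refine Tendsto.inv_tendsto_nhdsGT_zero (tendsto_nhdsWithin_iff.2 ⟨?_, ?_⟩)
  · simpa using hq.sqrt
  · filter_upwards [hpos] with τ h using Real.sqrt_pos.2 h

/-- The factor `√(2 t τ (t - τ))` in terms of the normalisations of the two densities. -/
lemma sqrt_mul_sqrt_cube {t s τ : ℝ} (ht : 0 < t) (hs : 0 < s) (hτ : 0 < τ) :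
    Real.sqrt (2 * t * (τ * s)) ^ 3 =
      t * Real.sqrt (2 * t) / Real.pi *
        (Real.sqrt (2 * Real.pi * s ^ 3) * Real.sqrt (2 * Real.pi * τ ^ 3)) := by
  have hpi := Real.pi_pos
  have e1 : Real.sqrt (2 * Real.pi * s ^ 3) * Real.sqrt (2 * Real.pi * τ ^ 3)
      = 2 * Real.pi * (τ * s) * Real.sqrt (τ * s) := by
    rw [← Real.sqrt_mul (by positivity),
      show 2 * Real.pi * s ^ 3 * (2 * Real.pi * τ ^ 3)
        = (2 * Real.pi * (τ * s)) ^ 2 * (τ * s) by ring,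
      Real.sqrt_mul (by positivity), Real.sqrt_sq (by positivity)]
  rw [e1, Real.sqrt_mul (by positivity), mul_pow, pow_succ, pow_succ (Real.sqrt (τ * s)),
    Real.sq_sqrt (by positivity), Real.sq_sqrt (by positivity)]
  field_simp

/-- First-passage densities form a convolution semigroup in the distance. -/
lemma integral_h_mul_h {t x y : ℝ} (μ : ℝ) (ht : 0 < t) (hx : 0 < x) (hy : 0 < y) :
    ∫ τ in (0 : ℝ)..t, h (t - τ) x μ * h τ y μ = h t (x + y) μ := by
  have hpi := Real.pi_pos
  have h2t : 0 < Real.sqrt (2 * t) := Real.sqrt_pos.2 (by positivity)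
  set C := Real.exp (-(x + y + μ * t) ^ 2 / (2 * t)) * (Real.sqrt (2 * t) / (2 * Real.pi * t ^ 2))
    with hC
  set q : ℝ → ℝ := fun τ => 2 * t * (τ * (t - τ)) with hq
  set a : ℝ → ℝ := fun τ => (x * τ - y * (t - τ)) * (Real.sqrt (q τ))⁻¹ with ha
  set b : ℝ → ℝ := fun τ => (x * τ - (-y) * (t - τ)) * (Real.sqrt (q τ))⁻¹ with hb
  set F : ℝ → ℝ := fun τ => -C * ((x + y) * gaussTail (a τ)
    + (y - x) * Real.exp (2 * x * y / t) * gaussTail (b τ)) with hF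
  have hqc : Continuous q := by fun_prop
  have hmem0 : ∀ᶠ τ in nhdsWithin (0 : ℝ) (Ioi 0), τ ∈ Ioo 0 t := Ioo_mem_nhdsGT ht
  have hmemt : ∀ᶠ τ in nhdsWithin t (Iio t), τ ∈ Ioo 0 t := Ioo_mem_nhdsLT ht
  have hqpos : ∀ τ ∈ Ioo 0 t, 0 < q τ := fun τ hτ => by
    have := hτ.1
    have := sub_pos.2 hτ.2
    simp only [hq]; positivity
  have hq0 : Tendsto (fun τ => (Real.sqrt (q τ))⁻¹) (nhdsWithin 0 (Ioi 0)) atTop :=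
    tendsto_inv_sqrt_atTop ((hqc.tendsto' 0 0 (by simp [hq])).mono_left nhdsWithin_le_nhds)
      (hmem0.mono hqpos)
  have hqt : Tendsto (fun τ => (Real.sqrt (q τ))⁻¹) (nhdsWithin t (Iio t)) atTop :=
    tendsto_inv_sqrt_atTop ((hqc.tendsto' t 0 (by simp [hq])).mono_left nhdsWithin_le_nhds)
      (hmemt.mono hqpos)
  have hnum (z c : ℝ) : Tendsto (fun τ => x * τ - z * (t - τ)) (nhds c)
      (nhds (x * c - z * (t - c))) := by
    have : Continuous (fun τ => x * τ - z * (t - τ)) := by fun_prop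
    exact this.tendsto c
  have ha0 : Tendsto a (nhdsWithin 0 (Ioi 0)) atBot :=
    ((hnum y 0).mono_left nhdsWithin_le_nhds).neg_mul_atTop (by nlinarith) hq0
  have hb0 : Tendsto b (nhdsWithin 0 (Ioi 0)) atTop :=
    ((hnum (-y) 0).mono_left nhdsWithin_le_nhds).pos_mul_atTop (by nlinarith) hq0
  have hat : Tendsto a (nhdsWithin t (Iio t)) atTop :=
    ((hnum y t).mono_left nhdsWithin_le_nhds).pos_mul_atTop (by nlinarith) hqt
  have hbt : Tendsto b (nhdsWithin t (Iio t)) atTop :=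
    ((hnum (-y) t).mono_left nhdsWithin_le_nhds).pos_mul_atTop (by nlinarith) hqt
  have hderiv : ∀ τ ∈ Ioo 0 t, HasDerivAt F (h (t - τ) x μ * h τ y μ) τ := by
    intro τ hτ
    have hda := hasDerivAt_scaled_ratio (x := x) (y := y) hτ
    have hdb := hasDerivAt_scaled_ratio (x := x) (y := -y) hτ
    have hd := ((((hasDerivAt_gaussTail (a τ)).comp τ hda).const_mul (x + y)).add
      (((hasDerivAt_gaussTail (b τ)).comp τ hdb).const_mul
        ((y - x) * Real.exp (2 * x * y / t)))).const_mul (-C)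
    refine hd.congr_deriv ?_
    have h0 := hτ.1
    have hs := sub_pos.2 hτ.2
    have hqp := hqpos τ hτ
    have easq : a τ ^ 2 = (x * τ - y * (t - τ)) ^ 2 / q τ := by
      simp only [ha]; rw [mul_pow, inv_pow, Real.sq_sqrt hqp.le]; rfl
    have ebsq : b τ ^ 2 = (x * τ + y * (t - τ)) ^ 2 / q τ := by
      simp only [hb]; rw [mul_pow, inv_pow, Real.sq_sqrt hqp.le, div_eq_mul_inv]; ring
    have eb : Real.exp (2 * x * y / t) * Real.exp (-b τ ^ 2) = Real.exp (-a τ ^ 2) := by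
      rw [← Real.exp_add, easq, ebsq]
      congr 1
      simp only [hq]
      field_simp
      ring
    have ee : Real.exp (-(x + μ * (t - τ)) ^ 2 / (2 * (t - τ)))
          * Real.exp (-(y + μ * τ) ^ 2 / (2 * τ))
        = Real.exp (-(x + y + μ * t) ^ 2 / (2 * t)) * Real.exp (-a τ ^ 2) := by
      rw [← Real.exp_add, ← Real.exp_add, easq]
      congr 1
      simp only [hq]
      field_simp
      ring
    have hp1 : 0 < Real.sqrt (2 * Real.pi * (t - τ) ^ 3) := Real.sqrt_pos.2 (by positivity)
    have hp2 : 0 < Real.sqrt (2 * Real.pi * τ ^ 3) := Real.sqrt_pos.2 (by positivity)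
    rw [sqrt_mul_sqrt_cube ht hs h0]
    unfold h
    rw [abs_of_pos hx, abs_of_pos hy]
    trans (x / Real.sqrt (2 * Real.pi * (t - τ) ^ 3) * (y / Real.sqrt (2 * Real.pi * τ ^ 3)))
      * (Real.exp (-(x + y + μ * t) ^ 2 / (2 * t)) * Real.exp (-a τ ^ 2))
    · rw [← eb, hC]
      field_simp
      ring
    · rw [← ee]; ring
  rw [integral_eq_of_hasDerivAt_of_tendsto_of_nonneg (f := F)
    (fa := -C * ((x + y) * Real.sqrt Real.pi + (y - x) * Real.exp (2 * x * y / t) * 0))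
    (fb := -C * ((x + y) * 0 + (y - x) * Real.exp (2 * x * y / t) * 0)) ht hderiv
    (fun τ _ => mul_nonneg (h_nonneg _ _ _) (h_nonneg _ _ _))
    (((tendsto_gaussTail_atBot.comp ha0).const_mul _).add
      ((tendsto_gaussTail_atTop.comp hb0).const_mul _) |>.const_mul _)
    (((tendsto_gaussTail_atTop.comp hat).const_mul _).add
      ((tendsto_gaussTail_atTop.comp hbt).const_mul _) |>.const_mul _)]
  have e3 : Real.sqrt (2 * Real.pi * t ^ 3) = t * Real.sqrt (2 * t) * Real.sqrt Real.pi := by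
    rw [show 2 * Real.pi * t ^ 3 = t ^ 2 * (2 * t) * Real.pi by ring,
      Real.sqrt_mul (by positivity), Real.sqrt_mul (by positivity), Real.sqrt_sq ht.le]
  have hsp := Real.sqrt_pos.2 hpi
  have e4 := Real.sq_sqrt hpi.le
  have e5 := Real.sq_sqrt (show 0 ≤ 2 * t by positivity)
  unfold h
  rw [abs_of_pos (by positivity), e3, hC]
  generalize Real.sqrt (2 * t) = r at h2t e5 ⊢
  simp only [mul_zero, add_zero, zero_sub, neg_mul, neg_neg]
  field_simp
  rw [e4, e5]
  ring

lemma integral_Ioi_h {t : ℝ} (μ : ℝ) (ht : 0 < t) :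
    ∫ x in Ioi (0 : ℝ), h t x μ =
      1 / Real.sqrt (2 * Real.pi * t) * Real.exp (-(μ ^ 2 * t) / 2)
        - μ / 2 * erfc (μ * Real.sqrt (t / 2)) := by
  have hpi := Real.pi_pos
  have h2t : 0 < Real.sqrt (2 * t) := Real.sqrt_pos.2 (by positivity)
  have hsq := Real.sq_sqrt (show 0 ≤ 2 * t by positivity)
  have hsp := Real.sqrt_pos.2 hpi
  set r := Real.sqrt (2 * t) with hr
  have e3 : Real.sqrt (2 * Real.pi * t ^ 3) = t * r * Real.sqrt Real.pi := by
    rw [show 2 * Real.pi * t ^ 3 = t ^ 2 * (2 * t) * Real.pi by ring,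
      Real.sqrt_mul (by positivity), Real.sqrt_mul (by positivity), Real.sqrt_sq ht.le]
  set P : ℝ → ℝ := fun x => -(1 / (r * Real.sqrt Real.pi)) *
      Real.exp (-((x + μ * t) / r) ^ 2)
    + μ / Real.sqrt Real.pi * gaussTail ((x + μ * t) / r) with hP
  have hd (x : ℝ) : HasDerivAt (fun x => (x + μ * t) / r) (1 / r) x :=
    ((hasDerivAt_id x).add_const _).div_const r
  have hderiv : ∀ x ∈ Ioi (0 : ℝ), HasDerivAt P (h t x μ) x := by
    intro x hx
    have := ((((hd x).pow 2).neg.exp).const_mul (-(1 / (r * Real.sqrt Real.pi)))).add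
      (((hasDerivAt_gaussTail _).comp x (hd x)).const_mul (μ / Real.sqrt Real.pi))
    refine this.congr_deriv ?_
    have ee : -(x + μ * t) ^ 2 / (2 * t) = -((x + μ * t) / r) ^ 2 := by
      rw [div_pow, hsq, neg_div]
    unfold h
    rw [abs_of_pos hx, e3, ee]
    simp only [Pi.pow_apply, Pi.neg_apply, Nat.cast_ofNat, Nat.add_one_sub_one, pow_one]
    field_simp
    rw [hsq]
    ring
  have hcont : ContinuousWithinAt P (Ici 0) 0 := by
    refine ContinuousAt.continuousWithinAt ?_
    refine ContinuousAt.add (by fun_prop) (ContinuousAt.mul continuousAt_const ?_)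
    exact ((hasDerivAt_gaussTail _).comp 0 (hd 0)).continuousAt
  have hlim : Tendsto (fun x => (x + μ * t) / r) atTop atTop :=
    (tendsto_atTop_add_const_right _ _ tendsto_id).atTop_div_const h2t
  have hexp : Tendsto (fun x => Real.exp (-((x + μ * t) / r) ^ 2)) atTop (nhds 0) :=
    Real.tendsto_exp_neg_atTop_nhds_zero.comp ((tendsto_pow_atTop two_ne_zero).comp hlim)
  have htop : Tendsto P atTop
      (nhds (-(1 / (r * Real.sqrt Real.pi)) * 0 + μ / Real.sqrt Real.pi * 0)) :=
    (hexp.const_mul _).add ((tendsto_gaussTail_atTop.comp hlim).const_mul _)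
  rw [integral_Ioi_of_hasDerivAt_of_nonneg hcont hderiv (fun x _ => h_nonneg _ _ _) htop]
  have ez : (0 + μ * t) / r = μ * Real.sqrt (t / 2) := by
    have : Real.sqrt (t / 2) = t / r := by
      rw [Real.sqrt_eq_iff_mul_self_eq (by positivity) (by positivity), ← pow_two, div_pow, hsq]
      field_simp
    rw [this]; ring
  have e6 : Real.sqrt (2 * Real.pi * t) = r * Real.sqrt Real.pi := by
    rw [hr, ← Real.sqrt_mul (by positivity)]; congr 1; ring
  have e7 : -(μ * Real.sqrt (t / 2)) ^ 2 = -(μ ^ 2 * t) / 2 := by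
    rw [mul_pow, Real.sq_sqrt (by positivity)]; ring
  simp only [hP, ez, e6, e7, erfc, gaussTail]
  field_simp
  ring

/-- Size of the discontinuity at `y = 0` of the transition density of skew Brownian
motion with alternating drifts `μ₊ = μ`, `μ₋ = −μ` started at `0`. -/
theorem jump_size_alternating_drifts (β μ t : ℝ)
    (hβ : β ∈ Ioo (-1 : ℝ) 1) (ht : 0 < t) :
    4 * β * ∫ b in Ioi (0 : ℝ), ∫ τ in (0 : ℝ)..t,
        h (t - τ) ((1 + β) * b) μ * h τ ((1 - β) * b) μ
      = Real.sqrt 2 * β / Real.sqrt (Real.pi * t) * Real.exp (-(μ ^ 2 * t) / 2)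
          - β * μ * erfc (μ * Real.sqrt (t / 2)) := by
  obtain ⟨h1, h2⟩ := hβ
  have hconv : ∫ b in Ioi (0 : ℝ), ∫ τ in (0 : ℝ)..t,
        h (t - τ) ((1 + β) * b) μ * h τ ((1 - β) * b) μ
      = ∫ b in Ioi (0 : ℝ), h t (2 * b) μ := by
    refine setIntegral_congr_fun measurableSet_Ioi fun b hb => ?_
    have hb' : 0 < b := hb
    have hx : 0 < (1 + β) * b := mul_pos (by linarith) hb'
    have hy : 0 < (1 - β) * b := mul_pos (by linarith) hb'
    simp only [integral_h_mul_h μ ht hx hy]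
    congr 1
    ring
  have hscale := integral_comp_mul_left_Ioi (fun x => h t x μ) 0 (two_pos : (0 : ℝ) < 2)
  rw [hconv, hscale, mul_zero, integral_Ioi_h μ ht, smul_eq_mul, mul_assoc 2 Real.pi t,
    Real.sqrt_mul (by norm_num)]
  have hp : 0 < Real.sqrt (Real.pi * t) := Real.sqrt_pos.2 (mul_pos Real.pi_pos ht)
  have hs2 := Real.sq_sqrt (show (0 : ℝ) ≤ 2 by norm_num)
  have hs2p : 0 < Real.sqrt 2 := Real.sqrt_pos.2 (by norm_num)
  field_simp
  linear_combination (-4 * β * Real.exp (-(t * μ ^ 2 / 2))) * hs2
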